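/- arXiv:2207.07401 — 3 statements merged into one kernel-verified Lean document; each statement's English description precedes it below -/
import Mathlib

section
/- Suppose κ is a measurable cardinal carrying a normal κ-complete ultrafilter 𝒰 that has a base of size κ⁺, i.e. there is a family ⟨B_α : α < κ⁺⟩ of members of 𝒰 such that every A ∈ 𝒰 contains some B_α (this is the statement that the normal ultrafilter number 𝔲^nor_κ equals κ⁺). Then λ → (λ, ω+1)² holds for every cardinal λ with cf(λ) = κ < λ. -/
open Cardinal Set

noncomputable section

/-- `F` is a (proper) filter on the cardinal `κ`; subsets of `κ` are coded as
sets of ordinals below `κ.ord`. -/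
def IsFilterOn (κ : Cardinal.{0}) (F : Set (Set Ordinal.{0})) : Prop :=
  (∀ A ∈ F, A ⊆ Set.Iio κ.ord) ∧
  Set.Iio κ.ord ∈ F ∧
  (∅ : Set Ordinal) ∉ F ∧
  (∀ A ∈ F, ∀ B : Set Ordinal, B ⊆ Set.Iio κ.ord → A ⊆ B → B ∈ F) ∧
  (∀ A ∈ F, ∀ B ∈ F, A ∩ B ∈ F)

/-- `F` is `κ`-complete: closed under intersections of fewer than `κ` of its members. -/
def IsKappaComplete (κ : Cardinal.{0}) (F : Set (Set Ordinal.{0})) : Prop :=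
  ∀ S : Set (Set Ordinal.{0}), S ⊆ F → S.Nonempty →
    Cardinal.mk ↥S < Cardinal.lift.{1, 0} κ → ⋂₀ S ∈ F

/-- `F` contains every co-bounded subset of `κ`. -/
def ContainsCobounded (κ : Cardinal.{0}) (F : Set (Set Ordinal.{0})) : Prop :=
  ∀ γ < κ.ord, {x : Ordinal | γ ≤ x ∧ x < κ.ord} ∈ F

/-- `F` is an ultrafilter on `κ`. -/
def IsUltraOn (κ : Cardinal.{0}) (F : Set (Set Ordinal.{0})) : Prop :=
  IsFilterOn κ F ∧
  ∀ A : Set Ordinal, A ⊆ Set.Iio κ.ord → (A ∈ F ∨ Set.Iio κ.ord \ A ∈ F)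

/-- `x ⊆* A` modulo sets of size `< κ`. -/
def AlmostSub (κ : Cardinal.{0}) (x A : Set Ordinal.{0}) : Prop :=
  Cardinal.mk ↥(x \ A) < Cardinal.lift.{1, 0} κ

/-- Galvin's property `Gal(F, μ, ν)`: every `ν`-indexed family of members of `F`
admits a subfamily of `μ` many indices whose intersection belongs to `F`. -/
def GalvinProp (F : Set (Set Ordinal.{0})) (μ ν : Cardinal.{0}) : Prop :=
  ∀ C : Ordinal → Set Ordinal, (∀ γ < ν.ord, C γ ∈ F) →
    ∃ I : Set Ordinal, I ⊆ Set.Iio ν.ord ∧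
      Cardinal.mk ↥I = Cardinal.lift.{1, 0} μ ∧ (⋂ γ ∈ I, C γ) ∈ F

/-- `B` is a set of ordinals of order type `ω + 1`. -/
def OtpOmegaSucc (B : Set Ordinal.{0}) : Prop :=
  ∃ (g : ℕ → Ordinal.{0}) (t : Ordinal.{0}), StrictMono g ∧ (∀ n, g n < t) ∧
    B = Set.range g ∪ {t}

/-- `c` is constantly `i` on the pairs from `H`. -/
def Mono (c : Ordinal.{0} → Ordinal.{0} → Fin 2) (H : Set Ordinal.{0}) (i : Fin 2) : Prop :=
  ∀ α ∈ H, ∀ β ∈ H, α < β → c α β = i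

/-- The partition relation `λ → (λ, ω + 1)²`. -/
def PartitionOmegaSuccRel (lam : Cardinal.{0}) : Prop :=
  ∀ c : Ordinal.{0} → Ordinal.{0} → Fin 2,
    (∃ H : Set Ordinal.{0}, H ⊆ Set.Iio lam.ord ∧
      Cardinal.mk ↥H = Cardinal.lift.{1, 0} lam ∧ Mono c H 0) ∨
    (∃ B : Set Ordinal.{0}, B ⊆ Set.Iio lam.ord ∧ OtpOmegaSucc B ∧ Mono c B 1)

/-- `F` is normal: closed under diagonal intersections of `κ`-sequences of members. -/
def IsNormalOn (κ : Cardinal.{0}) (F : Set (Set Ordinal.{0})) : Prop :=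
  ∀ A : Ordinal → Set Ordinal.{0}, (∀ α < κ.ord, A α ∈ F) →
    {β : Ordinal | β < κ.ord ∧ ∀ α < β, β ∈ A α} ∈ F

/-- The dual ideal of `F` contains every subset of `κ` of size `< κ`. -/
def SmallSetsInDual (κ : Cardinal.{0}) (F : Set (Set Ordinal.{0})) : Prop :=
  ∀ S : Set Ordinal.{0}, S ⊆ Set.Iio κ.ord →
    Cardinal.mk ↥S < Cardinal.lift.{1, 0} κ → Set.Iio κ.ord \ S ∈ F

theorem exists_rank_lt_succ_ord.{u} {α : Type u} {r : α → α → Prop} (hr : WellFounded r) (W : Set α)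
    {M : Cardinal} (hW : #W ≤ M) (hrW : ∀ b a, r b a → b ∈ W) :
    ∃ rk : α → Ordinal.{u}, (∀ a, rk a < (Order.succ M).ord) ∧ ∀ b a, r b a → rk b < rk a := by
  have : IsWellFounded α r := ⟨hr⟩
  refine ⟨IsWellFounded.rank r, fun a => ?_, fun b a h => IsWellFounded.rank_lt_of_rel h⟩
  have key : ∀ a, Set.Iio (IsWellFounded.rank r a) ⊆ IsWellFounded.rank r '' W := by
    intro a
    induction a using hr.induction with
    | _ a ih =>
      intro o ho
      rw [Set.mem_Iio, IsWellFounded.rank_eq, Ordinal.lt_iSup_iff] at ho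
      obtain ⟨⟨b, hb⟩, ho⟩ := ho
      rcases (Order.lt_succ_iff.1 ho).eq_or_lt with rfl | h
      · exact ⟨b, hrW _ _ hb, rfl⟩
      · exact ih b hb h
  rw [Cardinal.lt_ord, Order.lt_succ_iff]
  have h1 := Cardinal.mk_le_mk_of_subset (key a)
  rw [Cardinal.mk_Iio_ordinal] at h1
  have h2 := (Cardinal.lift_le.2 h1).trans (Cardinal.mk_image_le_lift (f := IsWellFounded.rank r))
  have h3 := h2.trans (Cardinal.lift_le.2 hW)
  rw [Cardinal.lift_lift] at h3
  exact Cardinal.lift_le.1 h3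

theorem mk_finset_subset_le {α : Type*} (N : Set α) :
    #{s : Finset α | (s : Set α) ⊆ N} ≤ max ℵ₀ #N := by
  classical
  refine le_trans ?_ (Cardinal.mk_list_le_max N)
  refine Cardinal.mk_le_of_surjective
    (f := fun l : List N => ⟨(l.map Subtype.val).toFinset, by intro x; simp; tauto⟩) ?_
  rintro ⟨s, hs⟩
  refine ⟨s.toList.attach.map fun x => ⟨x.1, hs (by simpa using x.2)⟩, ?_⟩
  ext x
  simp

theorem exists_finset_closed {α : Type*} {K : Cardinal} (hK : K.IsRegular) (hK' : ℵ₀ < K)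
    (F : Finset α → Set α) (hF : ∀ s, #(F s) < K) :
    ∃ N : Set α, #N < K ∧ ∀ s : Finset α, (s : Set α) ⊆ N → F s ⊆ N := by
  let step : Set α → Set α := fun N => N ∪ ⋃ s ∈ {s : Finset α | (s : Set α) ⊆ N}, F s
  let N : ℕ → Set α := fun n => step^[n] ∅
  have hN : ∀ n, N (n + 1) = step (N n) := fun n => Function.iterate_succ_apply' _ _ _
  have hmono : Monotone N := monotone_nat_of_le_succ fun n => by
    rw [hN]; exact Set.subset_union_left
  have hcard : ∀ n, #(N n) < K := by
    intro n
    induction n with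
    | zero => simpa [N] using hK.pos
    | succ n ih =>
      rw [hN]
      refine (Cardinal.mk_union_le _ _).trans_lt (Cardinal.add_lt_of_lt hK.aleph0_le ih ?_)
      refine (Cardinal.card_biUnion_lt_iff_forall_of_isRegular hK ?_).2 fun s _ => hF s
      exact (mk_finset_subset_le _).trans_lt (max_lt hK' ih)
  refine ⟨⋃ n, N n, ?_, fun s hs => ?_⟩
  · have h := Cardinal.mk_iUnion_le_sum_mk_lift (f := N)
    have h2 := Cardinal.sum_lt_lift_of_isRegular (f := fun n => #(N n)) hK
      (by simpa using hK') hcard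
    simp only [Cardinal.lift_id'] at h
    exact h.trans_lt h2
  · obtain ⟨n, hn⟩ := hmono.directed_le.exists_mem_subset_of_finset_subset_biUnion hs
    refine subset_trans ?_ (Set.subset_iUnion N (n + 1))
    rw [hN]
    exact fun x hx => Or.inr (Set.mem_biUnion (show s ∈ {s : Finset α | (s : Set α) ⊆ N n} from hn) hx)

theorem exists_const_on_large.{u} {α β : Type u} {K : Cardinal.{u}} (hK : K.IsRegular)
    {A : Set α} (hA : #A = K) (f : α → β) {T : Set β} (hT : #T < K) (hf : ∀ a ∈ A, f a ∈ T) :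
    ∃ b ∈ T, ∃ A' ⊆ A, #A' = K ∧ ∀ a ∈ A', f a = b := by
  obtain ⟨b, A', hA', h1, h2⟩ := Cardinal.infinite_pigeonhole_set
    (fun a : A => (⟨f a, hf a a.2⟩ : T)) K hA.ge hK.aleph0_le (by rwa [hK.cof_ord])
  exact ⟨b, b.2, A', hA', ((Cardinal.mk_le_mk_of_subset hA').trans hA.le).antisymm h1,
    fun a ha => congrArg Subtype.val (h2 ha)⟩

theorem mk_diff_eq_of_lt {α : Type*} {K : Cardinal} (hK : ℵ₀ ≤ K) {A R : Set α}
    (hA : #A = K) (hR : #R < K) : #(A \ R : Set α) = K := by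
  refine ((Cardinal.mk_le_mk_of_subset Set.sdiff_subset).trans hA.le).antisymm ?_
  by_contra! h
  have h1 := (Cardinal.le_mk_sdiff_add_mk A R).trans_lt (Cardinal.add_lt_of_lt hK h hR)
  exact h1.ne hA

theorem exists_bound_of_mk_lt {ν : Cardinal.{0}} (hν : ν.IsRegular) {N : Set Ordinal.{0}}
    (hN : N ⊆ Set.Iio ν.ord) (hc : #N < Cardinal.lift.{1} ν) :
    ∃ t < ν.ord, ∀ x ∈ N, x < t := by
  refine ⟨sSup ((· + 1) '' N), Ordinal.sSup_add_one_lt_of_lt_cof ?_ hN, fun x hx => ?_⟩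
  · rwa [← Ordinal.lift_cof, hν.cof_ord]
  · have : Small.{0} N := small_subset hN
    exact (Order.lt_add_one_iff.2 le_rfl).trans_le
      (le_csSup Ordinal.bddAbove_of_small (Set.mem_image_of_mem _ hx))

/-- `s` is monochromatic of colour `1` and remains so after putting `t` on top. -/
def OneBelow (c : Ordinal.{0} → Ordinal.{0} → Fin 2) (t : Ordinal.{0}) (s : Finset Ordinal.{0}) :
    Prop :=
  Mono c s 1 ∧ ∀ x ∈ s, x < t ∧ c x t = 1

/-- `s'` is a one-point end extension of `s` that lies in `D` and satisfies `OneBelow c t`. -/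
def EndExt (c : Ordinal.{0} → Ordinal.{0} → Fin 2) (D : Set Ordinal.{0}) (t : Ordinal.{0})
    (s' s : Finset Ordinal.{0}) : Prop :=
  ∃ α, (∀ x ∈ s, x < α) ∧ s' = insert α s ∧ (s' : Set Ordinal) ⊆ D ∧ OneBelow c t s'

theorem OneBelow.insert {c : Ordinal.{0} → Ordinal.{0} → Fin 2} {t α : Ordinal.{0}}
    {s : Finset Ordinal.{0}} (ht : OneBelow c t s) (hα : OneBelow c α s) (h : α < t)
    (h1 : c α t = 1) : OneBelow c t (insert α s) := by
  refine ⟨fun x hx y hy hxy => ?_, fun x hx => ?_⟩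
  · simp only [Finset.coe_insert, Set.mem_insert_iff, Finset.mem_coe] at hx hy
    rcases hx with rfl | hx <;> rcases hy with rfl | hy
    · exact absurd hxy (lt_irrefl _)
    · exact absurd hxy (hα.2 y hy).1.not_gt
    · exact (hα.2 x hx).2
    · exact ht.1 x hx y hy hxy
  · rcases Finset.mem_insert.1 hx with rfl | hx
    exacts [⟨h, h1⟩, ht.2 x hx]

theorem wellFounded_endExt {c : Ordinal.{0} → Ordinal.{0} → Fin 2} {δ : Ordinal.{0}}
    (hno : ¬ ∃ B : Set Ordinal.{0}, B ⊆ Set.Iio δ ∧ OtpOmegaSucc B ∧ Mono c B 1)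
    (D : Set Ordinal.{0}) {t : Ordinal.{0}} (ht : t < δ) : WellFounded (EndExt c D t) := by
  rw [wellFounded_iff_isEmpty_descending_chain]
  refine ⟨fun ⟨s, hs⟩ => hno ?_⟩
  choose α hα hins _ hone using hs
  have hmono : Monotone s := monotone_nat_of_le_succ fun n => by
    rw [hins]; exact Finset.subset_insert _ _
  have hmem : ∀ {m n}, m < n → α m ∈ s n := fun {m n} h =>
    hmono (Nat.succ_le_of_lt h) (by rw [hins]; exact Finset.mem_insert_self _ _)
  have hlt : StrictMono α := fun m n h => hα n _ (hmem h)
  have htop : ∀ n, α n < t ∧ c (α n) t = 1 := fun n => (hone n).2 _ (hmem n.lt_succ_self)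
  refine ⟨Set.range α ∪ {t}, ?_, ⟨α, t, hlt, fun n => (htop n).1, rfl⟩, ?_⟩
  · rintro x (⟨n, rfl⟩ | rfl)
    exacts [(htop n).1.trans ht, ht]
  · rintro x (⟨m, rfl⟩ | rfl) y (⟨n, rfl⟩ | rfl) hxy
    · exact (hone n).1 _ (hmem ((hlt.lt_iff_lt.1 hxy).trans n.lt_succ_self)) _
        (hmem n.lt_succ_self) hxy
    · exact (htop m).2
    · exact absurd hxy (htop n).1.not_gt
    · exact absurd hxy (lt_irrefl _)

/-- The Erdős–Rado relation `ν → (ν, ω + 1)²` for regular uncountable `ν`. -/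
theorem exists_mono_zero_of_isRegular {c : Ordinal.{0} → Ordinal.{0} → Fin 2} {ν : Cardinal.{0}}
    (hν : ν.IsRegular) (hν' : ℵ₀ < ν)
    (hno : ¬ ∃ B : Set Ordinal.{0}, B ⊆ Set.Iio ν.ord ∧ OtpOmegaSucc B ∧ Mono c B 1) :
    ∃ A ⊆ Set.Iio ν.ord, #A = Cardinal.lift.{1} ν ∧ Mono c A 0 := by
  by_contra! hA
  have hex : ∀ s : Finset Ordinal.{0}, ∃ Z : Set Ordinal.{0},
      Maximal (· ∈ {Z | Z ⊆ {t | t < ν.ord ∧ OneBelow c t s} ∧ Mono c Z 0}) Z := by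
    intro s
    refine zorn_subset _ fun C hC hchain => ⟨⋃₀ C, ⟨?_, ?_⟩, fun Z hZ => Set.subset_sUnion_of_mem hZ⟩
    · exact Set.sUnion_subset fun Z hZ => (hC hZ).1
    · rintro x ⟨X, hX, hx⟩ y ⟨Y, hY, hy⟩ hxy
      rcases hchain.total hX hY with h | h
      · exact (hC hY).2 x (h hx) y hy hxy
      · exact (hC hX).2 x hx y (h hy) hxy
  choose Z hZ using hex
  have hZν : ∀ s, Z s ⊆ Set.Iio ν.ord := fun s x hx => ((hZ s).prop.1 hx).1
  have hZcard : ∀ s, #(Z s) < Cardinal.lift.{1} ν := by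
    intro s
    refine lt_of_le_of_ne ?_ fun h => hA _ (hZν s) h (hZ s).prop.2
    simpa using Cardinal.mk_le_mk_of_subset (hZν s)
  obtain ⟨N₀, hN₀, hcl₀⟩ := exists_finset_closed hν.lift (by simpa using hν') Z hZcard
  obtain ⟨N, hNν, hN, hcl⟩ : ∃ N ⊆ Set.Iio ν.ord, #N < Cardinal.lift.{1} ν ∧
      ∀ s : Finset Ordinal.{0}, (s : Set Ordinal) ⊆ N → Z s ⊆ N :=
    ⟨N₀ ∩ Set.Iio ν.ord, Set.inter_subset_right,
      (Cardinal.mk_le_mk_of_subset Set.inter_subset_left).trans_lt hN₀, fun s hs =>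
      Set.subset_inter (hcl₀ s (hs.trans Set.inter_subset_left)) (hZν s)⟩
  obtain ⟨t, htν, ht⟩ := exists_bound_of_mk_lt hν hNν hN
  obtain ⟨s, ⟨hsN, hst⟩, hmin⟩ := (wellFounded_endExt hno N htν).has_min
    {s | (s : Set Ordinal) ⊆ N ∧ OneBelow c t s} ⟨∅, by simp, by simp [OneBelow, Mono]⟩
  have htZ : t ∉ Z s := fun h => lt_irrefl _ (ht t (hcl s hsN h))
  refine htZ ((hZ s).mem_of_prop_insert ⟨Set.insert_subset ⟨htν, hst⟩ (hZ s).prop.1, ?_⟩)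
  rintro x (rfl | hx) y (rfl | hy) hxy
  · exact absurd hxy (lt_irrefl _)
  · exact absurd hxy (ht y (hcl s hsN hy)).not_gt
  · by_contra h0
    have h1 : c x y = 1 := by omega
    have hxN := hcl s hsN hx
    have hins := hst.insert ((hZ s).prop.1 hx).2 hxy h1
    have hsub : ((insert x s : Finset Ordinal) : Set Ordinal) ⊆ N := by
      rw [Finset.coe_insert]; exact Set.insert_subset hxN hsN
    exact hmin _ ⟨hsub, hins⟩ ⟨x, fun y hy => (((hZ s).prop.1 hx).2.2 y hy).1, rfl, hsub, hins⟩
  · exact (hZ s).prop.2 x hx y hy hxy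

theorem IsUltraOn.sdiff_mem {κ : Cardinal.{0}} {U : Set (Set Ordinal.{0})} (hU : IsUltraOn κ U)
    {X Y : Set Ordinal.{0}} (hX : X ∈ U) (hYX : Y ⊆ X) (hY : Y ∉ U) : X \ Y ∈ U := by
  obtain ⟨⟨hsub, _, _, hup, hinter⟩, hultra⟩ := hU
  have hXκ := hsub X hX
  refine hup _ (hinter X hX _ ((hultra Y (hYX.trans hXκ)).resolve_left hY)) _
    (Set.sdiff_subset.trans hXκ) fun x hx => ⟨hx.1, hx.2.2⟩

/-- Consecutive blocks `A j` of regular sizes `L j`, monochromatic of colour `0`, such that the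
union of the earlier blocks has size at most `m j`, together with ordinal ranks `rk j t` that
decrease along end extensions. -/
structure IsLadder (κ : Cardinal.{0}) (c : Ordinal.{0} → Ordinal.{0} → Fin 2)
    (A : Ordinal.{0} → Set Ordinal.{0}) (m L : Ordinal.{0} → Cardinal.{1})
    (rk : Ordinal.{0} → Ordinal.{0} → Finset Ordinal.{0} → Ordinal.{1}) : Prop where
  regular : ∀ j < κ.ord, (L j).IsRegular
  lift_succ_lt : ∀ j < κ.ord, Cardinal.lift.{1} (Order.succ κ) < L j
  succ_lt : ∀ j < κ.ord, Order.succ (m j) < L j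
  card_eq : ∀ j < κ.ord, #(A j) = L j
  block_lt : ∀ i j, i < j → j < κ.ord → ∀ x ∈ A i, ∀ y ∈ A j, x < y
  card_below : ∀ j < κ.ord, #(⋃ i ∈ Set.Iio j, A i) ≤ m j
  mono : ∀ j < κ.ord, Mono c (A j) 0
  rk_lt : ∀ j < κ.ord, ∀ t ∈ A j, ∀ s, rk j t s < (Order.succ (m j)).ord
  rk_endExt : ∀ j < κ.ord, ∀ t ∈ A j, ∀ s' s, EndExt c (⋃ i ∈ Set.Iio j, A i) t s' s →
    rk j t s' < rk j t s

/-- The elements of `E` joined to `α` in colour `1`. -/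
def upNbhd (c : Ordinal.{0} → Ordinal.{0} → Fin 2) (E : Set Ordinal.{0}) (α : Ordinal.{0}) :
    Set Ordinal.{0} :=
  {t | t ∈ E ∧ c α t = 1}

/-- The levels `j ∈ X` at which `α` has a full-size colour-`1` neighbourhood in `E j`. -/
def bigLevels (c : Ordinal.{0} → Ordinal.{0} → Fin 2) (E : Ordinal.{0} → Set Ordinal.{0})
    (L : Ordinal.{0} → Cardinal.{1}) (X : Set Ordinal.{0}) (α : Ordinal.{0}) : Set Ordinal.{0} :=
  {j | j ∈ X ∧ #(upNbhd c (E j) α) = L j}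

section Ladder

variable {κ : Cardinal.{0}} {U : Set (Set Ordinal.{0})} {B : Ordinal.{0} → Set Ordinal.{0}}
  {c : Ordinal.{0} → Ordinal.{0} → Fin 2} {A E : Ordinal.{0} → Set Ordinal.{0}}
  {m L : Ordinal.{0} → Cardinal.{1}}
  {rk : Ordinal.{0} → Ordinal.{0} → Finset Ordinal.{0} → Ordinal.{1}} {X : Set Ordinal.{0}}

theorem IsLadder.exists_rk_const (h : IsLadder κ c A m L rk) {j : Ordinal.{0}} (hj : j < κ.ord)
    (s : Finset Ordinal.{0}) {F : Set Ordinal.{0}} (hF : F ⊆ A j) (hFc : #F = L j) :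
    ∃ ρ, ∃ F' ⊆ F, #F' = L j ∧ ∀ t ∈ F', rk j t s = ρ := by
  have hr := h.regular j hj
  let o := (Order.succ (m j)).ord
  have ho : #(Set.univ : Set o.ToType) < L j := by
    simpa [o] using h.succ_lt j hj
  have ho0 : 0 < o := by
    rw [Cardinal.lt_ord, Ordinal.card_zero]
    exact Order.bot_lt_succ _
  classical
  let f : Ordinal.{0} → o.ToType := fun t =>
    if h : rk j t s < o then Ordinal.ToType.mk ⟨rk j t s, h⟩ else Ordinal.ToType.mk ⟨0, ho0⟩
  obtain ⟨b, -, F', hF', hc, hb⟩ := exists_const_on_large hr hFc f ho fun _ _ => Set.mem_univ _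
  refine ⟨(Ordinal.ToType.mk.symm b).1, F', hF', hc, fun t ht => ?_⟩
  have hlt : rk j t s < o := h.rk_lt j hj t (hF (hF' ht)) s
  rw [← hb t ht]
  simp [f, hlt]

theorem IsLadder.exists_large_mono_of_small (h : IsLadder κ c A m L rk) (hU : IsUltraOn κ U)
    (hUnorm : IsNormalOn κ U) (hbase : ∀ A ∈ U, ∃ α < (Order.succ κ).ord, B α ⊆ A)
    (hBmem : ∀ α < (Order.succ κ).ord, B α ∈ U)
    (hX : X ∈ U) (hE : ∀ j ∈ X, E j ⊆ A j ∧ #(E j) = L j) {Y : Set Ordinal.{0}} (hY : Y ∈ U)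
    (hYX : Y ⊆ X) (hsmall : ∀ i ∈ Y, #{α | α ∈ E i ∧ bigLevels c E L X α ∉ U} = L i) :
    ∃ Z ∈ U, ∃ H ⊆ ⋃ j ∈ Set.Iio κ.ord, A j, Mono c H 0 ∧ ∀ j ∈ Z, L j ≤ #H := by
  have hXκ := hU.1.1 X hX
  have hidx : ∀ α, ∃ γ < (Order.succ κ).ord, bigLevels c E L X α ∉ U →
      B γ ⊆ X \ bigLevels c E L X α := by
    intro α
    by_cases hα : bigLevels c E L X α ∈ U
    · obtain ⟨γ, hγ, -⟩ := hbase X hX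
      exact ⟨γ, hγ, fun h => absurd hα h⟩
    · obtain ⟨γ, hγ, hsub⟩ := hbase _ (hU.sdiff_mem hX (fun _ hj => hj.1) hα)
      exact ⟨γ, hγ, fun _ => hsub⟩
  choose γ hγ hγB using hidx
  have hpick : ∀ i, ∃ C : Set Ordinal.{0}, ∃ g < (Order.succ κ).ord, i ∈ Y →
      C ⊆ E i ∧ #C = L i ∧ ∀ α ∈ C, ∀ j ∈ B g, j ∈ X ∧ #(upNbhd c (E j) α) < L j := by
    intro i
    by_cases hi : i ∈ Y
    · have hiκ := hXκ (hYX hi)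
      have hT : #(Set.Iio (Order.succ κ).ord) < L i := by
        simpa [← Cardinal.lift_succ] using h.lift_succ_lt i hiκ
      obtain ⟨g, hg, C, hC, hCc, hCg⟩ := exists_const_on_large (h.regular i hiκ) (hsmall i hi) γ hT
        fun α _ => hγ α
      refine ⟨C, g, hg, fun _ => ⟨fun α hα => (hC hα).1, hCc, fun α hα j hj => ?_⟩⟩
      have hj' := hγB α (hC hα).2 (by rwa [hCg α hα])
      refine ⟨hj'.1, lt_of_le_of_ne ?_ fun he => hj'.2 ⟨hj'.1, he⟩⟩
      exact (Cardinal.mk_le_mk_of_subset fun t ht => ht.1).trans (hE j hj'.1).2.le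
    · exact ⟨∅, γ 0, hγ 0, fun h => absurd h hi⟩
  choose C g hg hC using hpick
  let Z := {j | j < κ.ord ∧ ∀ i < j, j ∈ B (g i)} ∩ Y
  have hZ : Z ∈ U := hU.1.2.2.2.2 _ (hUnorm _ fun i _ => hBmem _ (hg i)) _ hY
  let R : Ordinal.{0} → Set Ordinal.{0} := fun j =>
    ⋃ α ∈ ⋃ i ∈ Set.Iio j ∩ Z, C i, upNbhd c (E j) α
  have hCA : ∀ j ∈ Z, C j ⊆ A j := fun j hj =>
    (hC j hj.2).1.trans (hE j (hYX hj.2)).1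
  have hR : ∀ j ∈ Z, #(R j) < L j := by
    intro j hj
    refine (Cardinal.card_biUnion_lt_iff_forall_of_isRegular (h.regular j hj.1.1) ?_).2 ?_
    · refine lt_of_le_of_lt ?_ ((Order.lt_succ (m j)).trans (h.succ_lt j hj.1.1))
      refine (Cardinal.mk_le_mk_of_subset ?_).trans (h.card_below j hj.1.1)
      exact Set.iUnion₂_subset fun i hi =>
        (hCA i hi.2).trans (Set.subset_biUnion_of_mem (u := A) hi.1)
    · intro α hα
      obtain ⟨i, hi, hαi⟩ := Set.mem_iUnion₂.1 hα
      exact ((hC i hi.2.2).2.2 α hαi j (hj.1.2 i hi.1)).2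
  refine ⟨Z, hZ, ⋃ j ∈ Z, C j \ R j, ?_, ?_, fun j hj => ?_⟩
  · exact Set.iUnion₂_subset fun j hj => (Set.sdiff_subset.trans (hCA j hj)).trans
      (Set.subset_biUnion_of_mem (u := A) (show j ∈ Set.Iio κ.ord from hj.1.1))
  · intro x hx y hy hxy
    obtain ⟨i, hi, hxi, -⟩ := Set.mem_iUnion₂.1 hx
    obtain ⟨j, hj, hyj, hyR⟩ := Set.mem_iUnion₂.1 hy
    rcases lt_trichotomy i j with hij | rfl | hij
    · by_contra h0
      refine hyR (Set.mem_biUnion (Set.mem_biUnion ⟨hij, hi⟩ hxi) ⟨(hC j hj.2).1 hyj, ?_⟩)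
      omega
    · exact h.mono i hi.1.1 x (hCA i hi hxi) y (hCA i hi hyj) hxy
    · exact absurd hxy (h.block_lt j i hij hi.1.1 y (hCA j hj hyj) x (hCA i hi hxi)).not_gt
  · rw [← mk_diff_eq_of_lt (h.regular j hj.1.1).aleph0_le (hC j hj.2).2.1 (hR j hj)]
    exact Cardinal.mk_le_mk_of_subset (Set.subset_biUnion_of_mem (u := fun j => C j \ R j) hj)

/-- A position in the construction of a colour-`1` chain: a finite chain, full-size sets of its
common upper neighbours at the levels in a set of the ultrafilter, and the constant ranks of the
chain on these sets. -/
structure Position where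
  chain : Finset Ordinal.{0}
  nbrs : Ordinal.{0} → Set Ordinal.{0}
  rank : Ordinal.{0} → Ordinal.{1}
  levels : Set Ordinal.{0}

/-- The properties required of a `Position`. -/
structure Position.IsGood (U : Set (Set Ordinal.{0})) (c : Ordinal.{0} → Ordinal.{0} → Fin 2)
    (A : Ordinal.{0} → Set Ordinal.{0}) (L : Ordinal.{0} → Cardinal.{1})
    (rk : Ordinal.{0} → Ordinal.{0} → Finset Ordinal.{0} → Ordinal.{1}) (p : Position) : Prop where
  levels_mem : p.levels ∈ U
  chain_subset : ∀ j ∈ p.levels, (p.chain : Set Ordinal) ⊆ ⋃ i ∈ Set.Iio j, A i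
  nbrs_subset : ∀ j ∈ p.levels, p.nbrs j ⊆ A j
  card_nbrs : ∀ j ∈ p.levels, #(p.nbrs j) = L j
  oneBelow : ∀ j ∈ p.levels, ∀ t ∈ p.nbrs j, OneBelow c t p.chain
  rk_eq : ∀ j ∈ p.levels, ∀ t ∈ p.nbrs j, rk j t p.chain = p.rank j

theorem IsLadder.exists_next (h : IsLadder κ c A m L rk) (hunc : ℵ₀ < κ) (hU : IsUltraOn κ U)
    (hUcb : ContainsCobounded κ U) (hUnorm : IsNormalOn κ U)
    (hbase : ∀ A ∈ U, ∃ α < (Order.succ κ).ord, B α ⊆ A)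
    (hBmem : ∀ α < (Order.succ κ).ord, B α ∈ U)
    (hno : ¬ ∃ Z ∈ U, ∃ H ⊆ ⋃ j ∈ Set.Iio κ.ord, A j, Mono c H 0 ∧ ∀ j ∈ Z, L j ≤ #H)
    {p : Position} (hp : p.IsGood U c A L rk) :
    ∃ q : Position, q.IsGood U c A L rk ∧ q.levels ⊆ p.levels ∧
      ∀ j ∈ q.levels, q.rank j < p.rank j := by
  have hXκ := hU.1.1 _ hp.levels_mem
  let Y := {i | i ∈ p.levels ∧
    #{α | α ∈ p.nbrs i ∧ bigLevels c p.nbrs L p.levels α ∉ U} = L i}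
  have hY : Y ∉ U := fun hY => hno (h.exists_large_mono_of_small hU hUnorm hbase hBmem
    hp.levels_mem (fun j hj => ⟨hp.nbrs_subset j hj, hp.card_nbrs j hj⟩) hY (fun _ hi => hi.1)
    fun i hi => hi.2)
  have hYc := hU.sdiff_mem hp.levels_mem (fun _ hi => hi.1) hY
  obtain ⟨i, hi, hiY⟩ : (p.levels \ Y).Nonempty := by
    rw [Set.nonempty_iff_ne_empty]
    exact fun he => hU.1.2.2.1 (he ▸ hYc)
  have hiκ := hXκ hi
  obtain ⟨α, hα, hbig⟩ : ∃ α ∈ p.nbrs i, bigLevels c p.nbrs L p.levels α ∈ U := by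
    by_contra! hcon
    refine hiY ⟨hi, ?_⟩
    rw [← hp.card_nbrs i hi]
    congr 2
    ext α
    exact ⟨fun hα => hα.1, fun hα => ⟨hα, hcon α hα⟩⟩
  have hαA := hp.nbrs_subset i hi hα
  have hX' := hU.1.2.2.2.2 _ hbig _ (hUcb (Order.succ i)
    ((Cardinal.isSuccLimit_ord hunc.le).succ_lt hiκ))
  set X' := bigLevels c p.nbrs L p.levels α ∩ {x | Order.succ i ≤ x ∧ x < κ.ord} with hX'def
  have hex : ∀ j, ∃ ρ F, j ∈ X' → F ⊆ upNbhd c (p.nbrs j) α ∧ #F = L j ∧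
      ∀ t ∈ F, rk j t (insert α p.chain) = ρ := by
    intro j
    by_cases hj : j ∈ X'
    · obtain ⟨ρ, F, hF⟩ := h.exists_rk_const hj.2.2 (insert α p.chain)
        (F := upNbhd c (p.nbrs j) α) (fun t ht => hp.nbrs_subset j hj.1.1 ht.1) hj.1.2
      exact ⟨ρ, F, fun _ => hF⟩
    · exact ⟨0, ∅, fun h => absurd h hj⟩
  choose ρ F hF using hex
  have hij : ∀ j ∈ X', i < j := fun j hj => Order.succ_le_iff.1 hj.2.1
  have hone : ∀ j ∈ X', ∀ t ∈ F j, OneBelow c t (insert α p.chain) := by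
    intro j hj t ht
    have ht' := (hF j hj).1 ht
    exact (hp.oneBelow j hj.1.1 t ht'.1).insert (hp.oneBelow i hi α hα)
      (h.block_lt i j (hij j hj) hj.2.2 α hαA t (hp.nbrs_subset j hj.1.1 ht'.1)) ht'.2
  have hsub : ∀ j ∈ X', ((insert α p.chain : Finset Ordinal) : Set Ordinal) ⊆
      ⋃ i ∈ Set.Iio j, A i := by
    intro j hj
    rw [Finset.coe_insert]
    exact Set.insert_subset (Set.mem_biUnion (hij j hj) hαA) (hp.chain_subset j hj.1.1)
  refine ⟨⟨insert α p.chain, F, ρ, X'⟩, ⟨hX', hsub, fun j hj t ht => ?_, fun j hj => (hF j hj).2.1,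
    hone, fun j hj => (hF j hj).2.2⟩, fun j hj => hj.1.1, fun j hj => ?_⟩
  · exact hp.nbrs_subset j hj.1.1 ((hF j hj).1 ht).1
  · have hne : (F j).Nonempty := by
      rw [← Set.nonempty_coe_sort, ← Cardinal.mk_ne_zero_iff, (hF j hj).2.1]
      exact (h.regular j hj.2.2).ne_zero
    obtain ⟨t, ht⟩ := hne
    have ht' := ((hF j hj).1 ht).1
    change ρ j < p.rank j
    rw [← (hF j hj).2.2 t ht, ← hp.rk_eq j hj.1.1 t ht']
    exact h.rk_endExt j hj.2.2 t (hp.nbrs_subset j hj.1.1 ht') _ _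
      ⟨α, fun x hx => ((hp.oneBelow i hi α hα).2 x hx).1, rfl, hsub j hj, hone j hj t ht⟩

theorem IsLadder.exists_large_mono (h : IsLadder κ c A m L rk) (hunc : ℵ₀ < κ)
    (hU : IsUltraOn κ U) (hUcomp : IsKappaComplete κ U)
    (hUcb : ContainsCobounded κ U) (hUnorm : IsNormalOn κ U)
    (hbase : ∀ A ∈ U, ∃ α < (Order.succ κ).ord, B α ⊆ A)
    (hBmem : ∀ α < (Order.succ κ).ord, B α ∈ U) :
    ∃ Z ∈ U, ∃ H ⊆ ⋃ j ∈ Set.Iio κ.ord, A j, Mono c H 0 ∧ ∀ j ∈ Z, L j ≤ #H := by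
  by_contra hno
  have hstart : ∃ p : Position, p.IsGood U c A L rk := by
    have hex : ∀ j, ∃ ρ F, j < κ.ord → F ⊆ A j ∧ #F = L j ∧ ∀ t ∈ F, rk j t ∅ = ρ := by
      intro j
      by_cases hj : j < κ.ord
      · obtain ⟨ρ, F, hF⟩ := h.exists_rk_const hj ∅ subset_rfl (h.card_eq j hj)
        exact ⟨ρ, F, fun _ => hF⟩
      · exact ⟨0, ∅, fun h => absurd h hj⟩
    choose ρ F hF using hex
    exact ⟨⟨∅, F, ρ, Set.Iio κ.ord⟩, ⟨hU.1.2.1, by simp, fun j hj => (hF j hj).1,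
      fun j hj => (hF j hj).2.1, fun _ _ _ _ => by simp [OneBelow, Mono],
      fun j hj => (hF j hj).2.2⟩⟩
  obtain ⟨p₀, hp₀⟩ := hstart
  choose! next hgood hsub hlt using fun (p : Position) (hp : p.IsGood U c A L rk) =>
    h.exists_next hunc hU hUcb hUnorm hbase hBmem hno hp
  let p : ℕ → Position := fun n => next^[n] p₀
  have hp : ∀ n, p (n + 1) = next (p n) := fun n => Function.iterate_succ_apply' _ _ _
  have hpg : ∀ n, (p n).IsGood U c A L rk := by
    intro n
    induction n with
    | zero => exact hp₀
    | succ n ih => rw [hp]; exact hgood _ ih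
  have hinter : ⋂₀ Set.range (fun n => (p n).levels) ∈ U := by
    refine hUcomp _ (Set.range_subset_iff.2 fun n => (hpg n).levels_mem) (Set.range_nonempty _) ?_
    exact (Cardinal.mk_le_aleph0_iff.2 (Set.countable_range _).to_subtype).trans_lt
      (by simpa using hunc)
  obtain ⟨j, hj⟩ : (⋂₀ Set.range (fun n => (p n).levels)).Nonempty := by
    rw [Set.nonempty_iff_ne_empty]
    exact fun he => hU.1.2.2.1 (he ▸ hinter)
  have hj' : ∀ n, j ∈ (p n).levels := fun n => hj _ ⟨n, rfl⟩
  refine not_strictAnti_of_wellFoundedLT (fun n => (p n).rank j)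
    (strictAnti_nat_of_succ_lt fun n => ?_)
  have := hlt (p n) (hpg n) j
  rw [← hp] at this
  exact this (hj' (n + 1))

end Ladder

theorem exists_cofinal_cardinals {κ lam : Cardinal.{0}} (hcof : lam.ord.cof = κ) :
    ∃ g : Ordinal.{0} → Cardinal.{0}, (∀ j < κ.ord, g j < lam) ∧
      ∀ μ < lam, ∃ j < κ.ord, μ ≤ g j := by
  obtain ⟨s, hs, hsc⟩ := Order.exists_cof_eq (Set.Iio lam.ord)
  have hcard : #(Set.Iio κ.ord) = #s := by
    rw [hsc, Ordinal.cof_Iio, ← Ordinal.lift_cof, hcof, Cardinal.mk_Iio_ordinal, Cardinal.card_ord]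
  obtain ⟨e⟩ := Cardinal.eq.1 hcard
  refine ⟨fun j => if h : j < κ.ord then (e ⟨j, h⟩).1.1.card else 0, fun j hj => ?_, fun μ hμ => ?_⟩
  · simpa [hj] using Cardinal.lt_ord.1 (e ⟨j, hj⟩).1.2
  · obtain ⟨x, hx, hμx⟩ := hs ⟨μ.ord, Cardinal.ord_lt_ord.2 hμ⟩
    obtain ⟨⟨j, hj⟩, hje⟩ := e.surjective ⟨x, hx⟩
    have hj' : j < κ.ord := hj
    refine ⟨j, hj', ?_⟩
    simp only [hj', dif_pos, hje]
    exact Cardinal.ord_le.1 hμx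

/-- A singular cardinal `lam` of cofinality `κ` is approached by a `κ`-sequence of cardinals, each
above the double successors of the earlier ones. -/
theorem exists_ladder_cardinals {κ lam : Cardinal.{0}} (hκ : ℵ₀ < κ) (hcof : lam.ord.cof = κ)
    (hlam : κ < lam) :
    ∃ M : Ordinal.{0} → Cardinal.{0}, (∀ j, Order.succ κ ≤ M j) ∧
      (∀ i j, i < j → Order.succ (Order.succ (M i)) ≤ M j) ∧
      (∀ j < κ.ord, Order.succ (Order.succ (M j)) < lam) ∧ ∀ μ < lam, ∃ j < κ.ord, μ ≤ M j := by
  obtain ⟨g, hg, hgcof⟩ := exists_cofinal_cardinals hcof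
  have hsing : lam.IsSingular := Cardinal.IsSingular.of_not_isRegular (hκ.le.trans hlam.le)
    fun h => hlam.ne (hcof.symm.trans h.cof_ord)
  have hsucc : ∀ {μ}, μ < lam → Order.succ μ < lam := fun h => hsing.isSuccLimit.succ_lt h
  obtain ⟨M, hM⟩ : ∃ M : Ordinal.{0} → Cardinal.{0}, ∀ j, M j =
      max (max (Order.succ κ) (g j)) (⨆ i : Set.Iio j, Order.succ (Order.succ (M i))) :=
    ⟨WellFoundedLT.fix fun j ih => max (max (Order.succ κ) (g j))
      (⨆ i : Set.Iio j, Order.succ (Order.succ (ih i.1 i.2))), fun j => WellFoundedLT.fix_eq _ j⟩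
  refine ⟨M, fun j => ?_, fun i j hij => ?_, fun j hj => hsucc (hsucc ?_), fun μ hμ => ?_⟩
  · rw [hM]; exact (le_max_left _ _).trans (le_max_left _ _)
  · rw [hM j]
    exact le_max_of_le_right (le_ciSup
      (f := fun i : Set.Iio j => Order.succ (Order.succ (M i))) Cardinal.bddAbove_of_small ⟨i, hij⟩)
  · induction j using WellFoundedLT.induction with
    | _ j ih =>
      rw [hM]
      refine max_lt (max_lt (hsucc hlam) (hg j hj)) (Cardinal.lift_iSup_lt_of_lt_cof_ord ?_ ?_)
      · rw [← Cardinal.lift_ord, ← Ordinal.lift_cof, hcof, Cardinal.mk_Iio_ordinal]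
        exact (Cardinal.lift_id' _).trans_lt (Cardinal.lift_lt.2 (Cardinal.lt_ord.1 hj))
      · exact fun i => hsucc (hsucc (ih i.1 i.2 (lt_trans i.2 hj)))
  · obtain ⟨j, hj, hμj⟩ := hgcof μ hμ
    refine ⟨j, hj, hμj.trans ?_⟩
    rw [hM]; exact (le_max_right _ _).trans (le_max_left _ _)

theorem exists_isLadder {κ : Cardinal.{0}} (hκ : ℵ₀ < κ) {δ : Ordinal.{0}}
    {c : Ordinal.{0} → Ordinal.{0} → Fin 2}
    (hno : ¬ ∃ B : Set Ordinal.{0}, B ⊆ Set.Iio δ ∧ OtpOmegaSucc B ∧ Mono c B 1)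
    {M : Ordinal.{0} → Cardinal.{0}} (hκM : ∀ j, Order.succ κ ≤ M j)
    (hMM : ∀ i j, i < j → Order.succ (Order.succ (M i)) ≤ M j)
    (hMδ : ∀ j < κ.ord, (Order.succ (Order.succ (M j))).ord ≤ δ) :
    ∃ A rk, IsLadder κ c A (fun j => Cardinal.lift.{1} (M j))
        (fun j => Cardinal.lift.{1} (Order.succ (Order.succ (M j)))) rk ∧
      ∀ j < κ.ord, A j ⊆ Set.Iio δ := by
  have hinf : ∀ j, ℵ₀ ≤ M j := fun j => hκ.le.trans ((Order.le_succ κ).trans (hκM j))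
  have hreg : ∀ j, (Order.succ (Order.succ (M j))).IsRegular := fun j =>
    Cardinal.isRegular_succ ((hinf j).trans (Order.le_succ _))
  have hlt : ∀ j, M j < Order.succ (Order.succ (M j)) := fun j =>
    (Order.lt_succ _).trans (Order.lt_succ _)
  have hex : ∀ j, ∃ A : Set Ordinal.{0}, j < κ.ord → A ⊆ Set.Iio (Order.succ (Order.succ (M j))).ord ∧
      #A = Cardinal.lift.{1} (Order.succ (Order.succ (M j))) ∧ Mono c A 0 := by
    intro j
    by_cases hj : j < κ.ord
    · obtain ⟨A, hA⟩ := exists_mono_zero_of_isRegular (c := c) (hreg j)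
        ((hinf j).trans_lt (hlt j))
        fun ⟨B, hB, h⟩ => hno ⟨B, hB.trans (Set.Iio_subset_Iio (hMδ j hj)), h⟩
      exact ⟨A, fun _ => hA⟩
    · exact ⟨∅, fun h => absurd h hj⟩
  choose A₀ hA₀ using hex
  let A : Ordinal.{0} → Set Ordinal.{0} := fun j => A₀ j \ Set.Iio (M j).ord
  have hAlt : ∀ i < κ.ord, ∀ j, i < j → A i ⊆ Set.Iio (M j).ord := fun i hi j hij x hx =>
    ((hA₀ i hi).1 hx.1).trans_le (Cardinal.ord_le_ord.2 (hMM i j hij))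
  have hbelow : ∀ j < κ.ord, #(⋃ i ∈ Set.Iio j, A i) ≤ Cardinal.lift.{1} (M j) := by
    intro j hj
    have hsub : (⋃ i ∈ Set.Iio j, A i) ⊆ Set.Iio (M j).ord :=
      Set.iUnion₂_subset fun i hi => hAlt i (lt_trans hi hj) j hi
    simpa using Cardinal.mk_le_mk_of_subset hsub
  have hAδ : ∀ j < κ.ord, A j ⊆ Set.Iio δ := fun j hj x hx =>
    ((hA₀ j hj).1 hx.1).trans_le (hMδ j hj)
  have hrk : ∀ j t, ∃ rk : Finset Ordinal.{0} → Ordinal.{1}, j < κ.ord → t ∈ A j →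
      (∀ s, rk s < (Order.succ (Cardinal.lift.{1} (M j))).ord) ∧
      ∀ s' s, EndExt c (⋃ i ∈ Set.Iio j, A i) t s' s → rk s' < rk s := by
    intro j t
    by_cases h : j < κ.ord ∧ t ∈ A j
    · obtain ⟨rk, hrk⟩ := exists_rank_lt_succ_ord
        (wellFounded_endExt hno (⋃ i ∈ Set.Iio j, A i) (hAδ j h.1 h.2))
        {s | (s : Set Ordinal) ⊆ ⋃ i ∈ Set.Iio j, A i} (M := Cardinal.lift.{1} (M j))
        ((mk_finset_subset_le _).trans (max_le (by simpa using hinf j) (hbelow j h.1)))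
        fun s' s ⟨_, _, _, hs', _⟩ => hs'
      exact ⟨rk, fun _ _ => hrk⟩
    · exact ⟨fun _ => 0, fun h1 h2 => absurd ⟨h1, h2⟩ h⟩
  choose rk hrk using hrk
  refine ⟨A, rk, ⟨fun j _ => (hreg j).lift, fun j _ => Cardinal.lift_lt.2 ((hκM j).trans_lt (hlt j)),
    fun j _ => ?_, fun j hj => ?_, fun i j hij hj x hx y hy => ?_, hbelow, fun j hj => ?_,
    fun j hj t ht => (hrk j t hj ht).1, fun j hj t ht => (hrk j t hj ht).2⟩, hAδ⟩
  · rw [← Cardinal.lift_succ]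
    exact Cardinal.lift_lt.2 (Order.lt_succ _)
  · refine mk_diff_eq_of_lt (hreg j).lift.aleph0_le (hA₀ j hj).2.1 ?_
    rw [Cardinal.mk_Iio_ordinal, Cardinal.card_ord]
    exact Cardinal.lift_lt.2 (hlt j)
  · exact (hAlt i (hij.trans hj) j hij hx).trans_le (not_lt.1 hy.2)
  · exact fun x hx y hy => (hA₀ j hj).2.2 x hx.1 y hy.1

/-- if the measurable cardinal `κ` carries a normal `κ`-complete
ultrafilter with a base of size `κ⁺` (i.e. `𝔲^nor_κ = κ⁺`), then
`λ → (λ, ω+1)²` holds for every `λ` with `cf(λ) = κ < λ`. -/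
theorem partition_from_small_base (κ : Cardinal.{0}) (hunc : ℵ₀ < κ)
    (U : Set (Set Ordinal.{0})) (hU : IsUltraOn κ U) (hUcomp : IsKappaComplete κ U)
    (hUcb : ContainsCobounded κ U) (hUnorm : IsNormalOn κ U)
    (B : Ordinal → Set Ordinal.{0})
    (hBmem : ∀ α < (Order.succ κ).ord, B α ∈ U)
    (hbase : ∀ A ∈ U, ∃ α < (Order.succ κ).ord, B α ⊆ A) :
    ∀ lam : Cardinal.{0}, lam.ord.cof = κ → κ < lam →
      PartitionOmegaSuccRel lam := by
  intro lam hcof hlam c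
  rw [or_iff_not_imp_right]
  intro hno
  obtain ⟨M, hκM, hMM, hMlam, hMcof⟩ := exists_ladder_cardinals hunc hcof hlam
  obtain ⟨A, rk, hladder, hAlam⟩ := exists_isLadder hunc hno hκM hMM
    fun j hj => Cardinal.ord_le_ord.2 (hMlam j hj).le
  obtain ⟨Z, hZ, H, hHA, hH, hZH⟩ :=
    hladder.exists_large_mono hunc hU hUcomp hUcb hUnorm hbase hBmem
  have hHlam : H ⊆ Set.Iio lam.ord := hHA.trans (Set.iUnion₂_subset hAlam)
  refine ⟨H, hHlam, le_antisymm (by simpa using Cardinal.mk_le_mk_of_subset hHlam) ?_, hH⟩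
  by_contra! hlt
  obtain ⟨μ, hμlam, hμ⟩ := Cardinal.lt_lift_iff.1 hlt
  obtain ⟨i, hi, hμi⟩ := hMcof μ hμlam
  obtain ⟨j, hjZ, hij, -⟩ : (Z ∩ {x | i ≤ x ∧ x < κ.ord}).Nonempty := by
    rw [Set.nonempty_iff_ne_empty]
    exact fun he => hU.1.2.2.1 (he ▸ hU.1.2.2.2.2 _ hZ _ (hUcb i hi))
  have hle : Order.succ (Order.succ (M j)) ≤ μ := by
    have := hZH j hjZ
    rwa [← hμ, Cardinal.lift_le] at this
  have hMij : M i ≤ M j := by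
    rcases hij.eq_or_lt with rfl | h
    · exact le_rfl
    · exact ((Order.le_succ _).trans (Order.le_succ _)).trans (hMM i j h)
  exact ((Order.lt_succ _).trans (Order.lt_succ _)).not_ge (hle.trans (hμi.trans hMij))
end
end

section
/- Let κ be a regular uncountable cardinal and let ⟨C_α : α < κ⁺⟩ be a family of subsets of κ⁺ that strongly fails Galvin's property, in the sense that for every set I ⊆ κ⁺ of size κ the intersection ⋂_{α ∈ I} C_α has size less than κ. Then there are pairwise distinct ordinals ⟨α_n : n < ω⟩ below κ⁺ such that ⋂_{n<ω} (κ⁺ \ C_{α_n}) is non-empty. -/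
open Cardinal Set

noncomputable section

/-- if `⟨C_α : α < κ⁺⟩` is a family of subsets of `κ⁺` strongly
failing Galvin's property (every subfamily of `κ` many indices has intersection
of size `< κ`), then countably many complements have a common element. -/
theorem countable_overlap_of_strong_failure (κ : Cardinal.{0}) (hreg : κ.IsRegular)
    (hunc : ℵ₀ < κ) (C : Ordinal → Set Ordinal.{0})
    (hsub : ∀ α < (Order.succ κ).ord, C α ⊆ Set.Iio (Order.succ κ).ord)
    (hfail : ∀ I : Set Ordinal.{0}, I ⊆ Set.Iio (Order.succ κ).ord →
      Cardinal.mk ↥I = Cardinal.lift.{1, 0} κ →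
      Cardinal.mk ↥(⋂ α ∈ I, C α) < Cardinal.lift.{1, 0} κ) :
    ∃ a : ℕ → Ordinal.{0}, (∀ n, a n < (Order.succ κ).ord) ∧ Function.Injective a ∧
      (⋂ n : ℕ, (Set.Iio (Order.succ κ).ord \ C (a n))).Nonempty := by
  set S := Set.Iio (Order.succ κ).ord with hS
  have hinf : ℵ₀ ≤ lift.{1, 0} κ := aleph0_le_lift.2 hunc.le
  suffices h : ∃ β ∈ S, {α | α ∈ S ∧ β ∉ C α}.Infinite by
    obtain ⟨β, hβ, h⟩ := h
    refine ⟨fun n => (h.natEmbedding _ n : Ordinal), fun n => (h.natEmbedding _ n).2.1,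
      fun m n hmn => (h.natEmbedding _).injective (Subtype.ext hmn), β, ?_⟩
    exact mem_iInter.2 fun n => ⟨hβ, (h.natEmbedding _ n).2.2⟩
  by_contra! hfin
  set J := Set.Iio κ.ord with hJ
  have hJS : J ⊆ S := Iio_subset_Iio (ord_le_ord.2 (Order.le_succ κ))
  have hJcard : #J = lift.{1, 0} κ := by rw [hJ, mk_Iio_ordinal, card_ord]
  have : Infinite J := infinite_iff.2 (hJcard ▸ hinf)
  have hJfin (β : S) : {α : J | (β : Ordinal) ∉ C α}.Finite :=
    ((hfin β β.2).preimage Subtype.val_injective.injOn).subset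
      fun α hα => ⟨hJS α.2, hα⟩
  -- More than `κ` many `β` miss `C α` for exactly the same finite set of indices `α ∈ J`.
  obtain ⟨F, hF⟩ := infinite_pigeonhole_card_lt (fun β : S => (hJfin β).toFinset)
    (by rw [mk_finset_of_infinite, hJcard, hS, mk_Iio_ordinal, card_ord, lift_lt]
        exact Order.lt_succ κ)
    (by rw [hS, mk_Iio_ordinal, card_ord, aleph0_le_lift]
        exact hunc.le.trans (Order.le_succ κ))
  rw [mk_finset_of_infinite, hJcard] at hF
  have hI : #(Subtype.val '' ((F : Set J)ᶜ)) = lift.{1, 0} κ := by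
    rw [mk_image_eq Subtype.val_injective, mk_compl_of_infinite, hJcard]
    exact (lt_aleph0_of_finite _).trans_le (hJcard ▸ hinf)
  refine (hfail _ ?_ hI).not_ge (hF.le.trans ?_)
  · rintro _ ⟨α, -, rfl⟩
    exact hJS α.2
  · rw [← mk_image_eq (s := _ ⁻¹' {F}) Subtype.val_injective]
    refine mk_le_mk_of_subset ?_
    rintro _ ⟨β, hβ, rfl⟩
    simp only [mem_iInter]
    rintro _ ⟨α, hα, rfl⟩
    by_contra hn
    exact hα ((show (hJfin β).toFinset = F from hβ) ▸ (hJfin β).mem_toFinset.2 hn)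
end
end

section
/- Let κ be a measurable cardinal and let ⟨C_α : α < κ⁺⟩ be a family of subsets of κ⁺ that strongly fails Galvin's property, in the sense that for every set I ⊆ κ⁺ of size κ the intersection ⋂_{α ∈ I} C_α has size less than κ. Then there is a set S ⊆ κ⁺ of size κ such that ⋂_{α ∈ S} (κ⁺ \ C_α) is non-empty. -/
open Cardinal Set

noncomputable section

/-- if `κ` is measurable and `⟨C_α : α < κ⁺⟩` is a family of
subsets of `κ⁺` strongly failing Galvin's property, then there is a set `S` of
`κ` many indices whose complements have a common element. -/
theorem kappa_overlap_of_strong_failure (κ : Cardinal.{0}) (hunc : ℵ₀ < κ)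
    (hmeas : ∃ U : Set (Set Ordinal.{0}),
      IsUltraOn κ U ∧ IsKappaComplete κ U ∧ ContainsCobounded κ U)
    (C : Ordinal → Set Ordinal.{0})
    (hsub : ∀ α < (Order.succ κ).ord, C α ⊆ Set.Iio (Order.succ κ).ord)
    (hfail : ∀ I : Set Ordinal.{0}, I ⊆ Set.Iio (Order.succ κ).ord →
      Cardinal.mk ↥I = Cardinal.lift.{1, 0} κ →
      Cardinal.mk ↥(⋂ α ∈ I, C α) < Cardinal.lift.{1, 0} κ) :
    ∃ S : Set Ordinal.{0}, S ⊆ Set.Iio (Order.succ κ).ord ∧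
      Cardinal.mk ↥S = Cardinal.lift.{1, 0} κ ∧
      (⋂ α ∈ S, (Set.Iio (Order.succ κ).ord \ C α)).Nonempty := by
  have hmk : #(Iio (Order.succ κ).ord) = lift.{1, 0} (Order.succ κ) := by
    rw [mk_Iio_ordinal, card_ord]
  have hmk' : #(Iio κ.ord) = lift.{1, 0} κ := by
    rw [mk_Iio_ordinal, card_ord]
  have hinf : ℵ₀ ≤ lift.{1, 0} κ := by simpa using hunc.le
  have hlt : κ.ord ≤ (Order.succ κ).ord := ord_le_ord.2 (Order.le_succ κ)
  by_contra hno
  have hsmall : ∀ β < (Order.succ κ).ord,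
      #{α | α ∈ Iio (Order.succ κ).ord ∧ β ∉ C α} < lift.{1, 0} κ := by
    intro β hβ
    by_contra! hle
    obtain ⟨S, hS, hcard⟩ := le_mk_iff_exists_subset.1 hle
    exact hno ⟨S, fun α hα => (hS hα).1, hcard, β, mem_iInter₂.2 fun α hα => ⟨hβ, (hS hα).2⟩⟩
  set T : Set Ordinal.{0} :=
    ⋃ β : Iio κ.ord, {α | α ∈ Iio (Order.succ κ).ord ∧ β.1 ∉ C α}
  have hTcard : #T ≤ lift.{1, 0} κ := by
    refine (mk_iUnion_le _).trans ?_
    rw [hmk']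
    refine (mul_le_mul' le_rfl (ciSup_le' fun β => ?_)).trans (mul_eq_self hinf).le
    exact (hsmall β (β.2.trans_le hlt)).le
  have hlarge : lift.{1, 0} κ ≤ #(Iio (Order.succ κ).ord \ T : Set Ordinal.{0}) := by
    by_contra! hcon
    have hle : #(Iio (Order.succ κ).ord) ≤ lift.{1, 0} κ := calc
      #(Iio (Order.succ κ).ord) ≤ #((Iio (Order.succ κ).ord \ T) ∪ T : Set Ordinal.{0}) :=
        mk_le_mk_of_subset (by rw [sdiff_union_self]; exact subset_union_left)
      _ ≤ _ := mk_union_le _ _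
      _ ≤ lift.{1, 0} κ + lift.{1, 0} κ := add_le_add hcon.le hTcard
      _ = lift.{1, 0} κ := add_eq_self hinf
    rw [hmk, lift_le] at hle
    exact (Order.lt_succ κ).not_ge hle
  obtain ⟨I, hI, hIcard⟩ := le_mk_iff_exists_subset.1 hlarge
  refine (hfail I (fun α hα => (hI hα).1) hIcard).not_ge ?_
  rw [← hmk']
  refine mk_le_mk_of_subset fun β hβ => mem_iInter₂.2 fun α hα => ?_
  by_contra hβα
  exact (hI hα).2 (mem_iUnion.2 ⟨⟨β, hβ⟩, (hI hα).1, hβα⟩)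
end
end
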